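/- Let E and F be real inner product spaces (Hilbert spaces), let L : E × F → ℝ be a loss function that is differentiable in each variable, and suppose the map w ↦ ∇_α L(w, α) (the gradient of L with respect to its second argument) is Lipschitz in w with constant K ≥ 0, uniformly in α, i.e. for all w₁, w₂ ∈ E and α ∈ F, ‖∇_α L(w₁, α) − ∇_α L(w₂, α)‖ ≤ K ‖w₁ − w₂‖. Fix learning rates r₁, r₂ > 0 and a current iterate (w, α). Define the updated weight w' = w − r₁ ∇_w L(w, α), the simultaneous (joint) update α_joint = α − r₂ ∇_α L(w, α), and the alternate (DMF) update α_alt = α − r₂ ∇_α L(w', α). Then ‖α_joint − α_alt‖ ≤ r₁ r₂ K ‖∇_w L(w, α)‖. In particular, the discrepancy between one step of joint optimization and one step of alternate optimization is bounded by a constant multiple of the product r₁ r₂ of the two learning rates. -/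

import Mathlib

/-- Proposition 1 (discrepancy between one joint step and one alternate (DMF) step):
if the gradient of `L` in its second argument is `K`-Lipschitz in the first argument
(uniformly in the second), then the joint and alternate `α`-updates differ by at most
`r₁ * r₂ * K * ‖∇_w L (w, α)‖`. -/
theorem dmf_alternate_vs_joint_step
    {E F : Type*} [NormedAddCommGroup E] [InnerProductSpace ℝ E] [CompleteSpace E]
    [NormedAddCommGroup F] [InnerProductSpace ℝ F] [CompleteSpace F]
    (L : E × F → ℝ)
    (hdiffw : ∀ (w : E) (α : F), DifferentiableAt ℝ (fun w' : E => L (w', α)) w)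
    (hdiffα : ∀ (w : E) (α : F), DifferentiableAt ℝ (fun α' : F => L (w, α')) α)
    (K : ℝ) (hK : 0 ≤ K)
    (hLip : ∀ (w₁ w₂ : E) (α : F),
      ‖gradient (fun α' : F => L (w₁, α')) α - gradient (fun α' : F => L (w₂, α')) α‖
        ≤ K * ‖w₁ - w₂‖)
    (r₁ r₂ : ℝ) (hr₁ : 0 < r₁) (hr₂ : 0 < r₂)
    (w : E) (α : F)
    (w' : E) (hw' : w' = w - r₁ • gradient (fun w'' : E => L (w'', α)) w)
    (αjoint : F) (hjoint : αjoint = α - r₂ • gradient (fun α' : F => L (w, α')) α)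
    (αalt : F) (halt : αalt = α - r₂ • gradient (fun α' : F => L (w', α')) α) :
    ‖αjoint - αalt‖ ≤ r₁ * r₂ * K * ‖gradient (fun w'' : E => L (w'', α)) w‖ := by
  have hstep : ‖w' - w‖ = r₁ * ‖gradient (fun w'' : E => L (w'', α)) w‖ := by
    rw [hw', sub_sub_cancel_left, norm_neg, norm_smul, Real.norm_of_nonneg hr₁.le]
  calc ‖αjoint - αalt‖
      = r₂ * ‖gradient (fun α' : F => L (w', α')) α - gradient (fun α' : F => L (w, α')) α‖ := by
        rw [hjoint, halt, sub_sub_sub_cancel_left, ← smul_sub, norm_smul,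
          Real.norm_of_nonneg hr₂.le]
    _ ≤ r₂ * (K * ‖w' - w‖) := mul_le_mul_of_nonneg_left (hLip w' w α) hr₂.le
    _ = r₁ * r₂ * K * ‖gradient (fun w'' : E => L (w'', α)) w‖ := by
        rw [hstep]
        ring
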